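/- A finite-dimensional quantum state ρ is passive for Hamiltonian H (i.e., Tr(Hρ) ≤ Tr(H UρU†) for every unitary U) if and only if ρ is diagonal in an eigenbasis of H with eigenvalues ordered oppositely to the energies: ρ = ∑_m p_m |m⟩⟨m| where H|m⟩ = E_m|m⟩, E₀ ≤ E₁ ≤ ⋯ and p₀ ≥ p₁ ≥ ⋯. -/

import Mathlib

open Matrix
open scoped ComplexOrder

lemma trace_formula {n : ℕ} (E q : Fin n → ℝ) (W : Matrix (Fin n) (Fin n) ℂ) :
    (Matrix.trace (Matrix.diagonal (fun m => (E m : ℂ)) *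
      (W * Matrix.diagonal (fun m => (q m : ℂ)) * Wᴴ))).re
      = ∑ i, ∑ j, E i * q j * Complex.normSq (W i j) := by
  simp only [Matrix.trace, Matrix.diag_apply, Matrix.diagonal_mul]
  rw [Complex.re_sum]
  refine Finset.sum_congr rfl fun i _ => ?_
  rw [Matrix.mul_apply, Finset.mul_sum, Complex.re_sum]
  refine Finset.sum_congr rfl fun j _ => ?_
  rw [Matrix.mul_diagonal, Matrix.conjTranspose_apply]
  simp [Complex.normSq_apply]
  ring

lemma ds_bound {n : ℕ} (E q : Fin n → ℝ) (hE : Monotone E) (hq : Antitone q)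
    (W : Matrix (Fin n) (Fin n) ℂ) (hW : W ∈ Matrix.unitaryGroup (Fin n) ℂ) :
    ∑ i, E i * q i ≤ ∑ i, ∑ j, E i * q j * Complex.normSq (W i j) := by
  have hM : (Matrix.of fun i j => Complex.normSq (W i j)) ∈ doublyStochastic ℝ (Fin n) := by
    rw [mem_doublyStochastic_iff_sum]
    refine ⟨fun i j => Complex.normSq_nonneg _, fun i => ?_, fun j => ?_⟩
    · have h := congrFun (congrFun (Matrix.mem_unitaryGroup_iff.1 hW) i) i
      rw [Matrix.mul_apply] at h
      have h' := congrArg Complex.re h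
      rw [Complex.re_sum] at h'
      simpa [Matrix.star_apply, Complex.normSq_apply] using h'
    · have h := congrFun (congrFun (Matrix.mem_unitaryGroup_iff'.1 hW) j) j
      rw [Matrix.mul_apply] at h
      have h' := congrArg Complex.re h
      rw [Complex.re_sum] at h'
      simpa [Matrix.star_apply, Complex.normSq_apply] using h'
  obtain ⟨w, hw0, hw1, hw⟩ := exists_eq_sum_perm_of_mem_doublyStochastic hM
  have hav : Antivary E q := hE.antivary hq
  have key : ∀ i j, Complex.normSq (W i j) = ∑ σ, w σ * (if σ i = j then 1 else 0) := by
    intro i j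
    have := congrFun (congrFun hw i) j
    simp only [Matrix.sum_apply, Matrix.smul_apply, Matrix.of_apply, smul_eq_mul] at this
    rw [← this]
    refine Finset.sum_congr rfl fun σ _ => ?_
    simp [Equiv.Perm.permMatrix, PEquiv.toMatrix_apply, eq_comm]
  have : ∑ i, ∑ j, E i * q j * Complex.normSq (W i j) = ∑ σ, w σ * ∑ i, E i * q (σ i) := by
    simp only [key, Finset.mul_sum]
    conv_lhs => enter [2, i]; rw [Finset.sum_comm]
    rw [Finset.sum_comm]
    refine Finset.sum_congr rfl fun σ _ => Finset.sum_congr rfl fun i _ => ?_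
    simp
    ring
  rw [this]
  calc ∑ i, E i * q i = ∑ σ : Equiv.Perm (Fin n), w σ * ∑ i, E i * q i := by
        rw [← Finset.sum_mul, hw1, one_mul]
    _ ≤ _ := Finset.sum_le_sum fun σ _ =>
        mul_le_mul_of_nonneg_left hav.sum_mul_le_sum_mul_comp_perm (hw0 σ)

section
attribute [local instance] Matrix.linftyOpNormedRing Matrix.linftyOpNormedAlgebra

lemma commute_of_passive {n : ℕ} (H ρ : Matrix (Fin n) (Fin n) ℂ)
    (hH : H.IsHermitian) (hρ : ρ.IsHermitian)
    (h : ∀ U ∈ Matrix.unitaryGroup (Fin n) ℂ,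
        ((H * ρ).trace).re ≤ ((H * (U * ρ * Uᴴ)).trace).re) : H * ρ = ρ * H := by
  set A := ρ * H - H * ρ with hA
  have hAs : Aᴴ = -A := by
    simp [hA, Matrix.conjTranspose_sub, Matrix.conjTranspose_mul, hH.eq, hρ.eq]
  have hexp : ∀ t : ℝ, (NormedSpace.exp (t • A))ᴴ = NormedSpace.exp (t • (-A)) := by
    intro t
    rw [← Matrix.exp_conjTranspose, Matrix.conjTranspose_smul, hAs]
    simp
  have hU : ∀ t : ℝ, NormedSpace.exp (t • A) ∈ Matrix.unitaryGroup (Fin n) ℂ := by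
    intro t
    rw [Matrix.mem_unitaryGroup_iff, Matrix.star_eq_conjTranspose, hexp,
      ← Matrix.exp_add_of_commute]
    · simp
    · rw [smul_neg]; exact (Commute.refl _).neg_right
  have hd1 := hasDerivAt_exp_smul_const (𝕂 := ℝ) A (0:ℝ)
  have hd2 := hasDerivAt_exp_smul_const (𝕂 := ℝ) (-A) (0:ℝ)
  have hd := ((hd1.mul_const ρ).mul hd2).const_mul H
  let L : Matrix (Fin n) (Fin n) ℂ →ₗ[ℝ] ℝ :=
    Complex.reLm ∘ₗ (Matrix.traceLinearMap (Fin n) ℝ ℂ)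
  have hL := (LinearMap.toContinuousLinearMap L).hasFDerivAt.comp_hasDerivAt (0:ℝ) hd
  have hmin : IsLocalMin (fun t : ℝ => L (H * (NormedSpace.exp (t • A) * ρ *
      NormedSpace.exp (t • (-A))))) 0 := by
    refine Filter.Eventually.of_forall fun t => ?_
    have := h _ (hU t)
    rw [hexp] at this
    simpa [L] using this
  have h0 := hmin.hasDerivAt_eq_zero hL
  have h1 : (Matrix.trace (Aᴴ * A)).re = 0 := by
    have h2 : (Matrix.trace (H * (A * ρ - ρ * A))).re = 0 := by
      have h0' : L _ = 0 := h0
      simpa [L, sub_eq_add_neg] using h0'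
    have h3 : Matrix.trace (H * (A * ρ - ρ * A)) = Matrix.trace (A * A) := by
      conv_rhs => rw [hA, Matrix.mul_sub]
      rw [← hA, Matrix.mul_sub, Matrix.trace_sub, Matrix.trace_sub]
      congr 1
      · rw [Matrix.trace_mul_comm, Matrix.mul_assoc]
      · rw [← Matrix.mul_assoc, Matrix.trace_mul_comm]
    rw [h3] at h2
    rw [hAs]; simpa using h2
  have h4 : Matrix.trace (Aᴴ * A) = 0 := by
    have hp := (Matrix.posSemidef_conjTranspose_mul_self A).trace_nonneg
    apply Complex.ext
    · simpa using h1
    · simpa using (Complex.le_def.1 hp).2.symm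
  have h5 := Matrix.trace_conjTranspose_mul_self_eq_zero_iff.1 h4
  exact (sub_eq_zero.1 (hA ▸ h5)).symm
end

lemma real_diag {n : ℕ} (H V : Matrix (Fin n) (Fin n) ℂ) (hH : H.IsHermitian)
    (hV : V ∈ Matrix.unitaryGroup (Fin n) ℂ) (d : Fin n → ℂ)
    (h : H * V = V * Matrix.diagonal d) :
    H = V * Matrix.diagonal (fun m => ((d m).re : ℂ)) * Vᴴ := by
  have h1 : V * Vᴴ = 1 := Matrix.mem_unitaryGroup_iff.1 hV
  have h2 : Vᴴ * V = 1 := Matrix.mem_unitaryGroup_iff'.1 hV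
  have hD : Matrix.diagonal d = Vᴴ * H * V := by
    rw [Matrix.mul_assoc, h, ← Matrix.mul_assoc, h2, Matrix.one_mul]
  have hDH : (Matrix.diagonal d)ᴴ = Matrix.diagonal d := by
    rw [hD]
    simp [Matrix.conjTranspose_mul, hH.eq, Matrix.mul_assoc]
  have hd : (fun m => ((d m).re : ℂ)) = d := by
    funext m
    have := congrFun (congrFun hDH m) m
    rw [Matrix.conjTranspose_apply, Matrix.diagonal_apply_eq] at this
    exact Complex.conj_eq_iff_re.1 this
  rw [hd, ← h, Matrix.mul_assoc, h1, Matrix.mul_one]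

lemma simul_diag {n : ℕ} (H ρ : Matrix (Fin n) (Fin n) ℂ)
    (hH : H.IsHermitian) (hρ : ρ.IsHermitian) (hc : H * ρ = ρ * H) :
    ∃ V ∈ Matrix.unitaryGroup (Fin n) ℂ, ∃ E q : Fin n → ℝ,
        H = V * Matrix.diagonal (fun m => (E m : ℂ)) * Vᴴ ∧
        ρ = V * Matrix.diagonal (fun m => (q m : ℂ)) * Vᴴ := by
  classical
  have sA := Matrix.isSymmetric_toEuclideanLin_iff.2 hH
  have sB := Matrix.isSymmetric_toEuclideanLin_iff.2 hρ
  have hAB : Commute (Matrix.toEuclideanLin H) (Matrix.toEuclideanLin ρ) := by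
    ext x
    simp [Matrix.toLpLin_apply, hc]
  have hI := LinearMap.IsSymmetric.directSum_isInternal_of_commute sA sB hAB
  have hO := LinearMap.IsSymmetric.orthogonalFamily_eigenspace_inf_eigenspace sA sB
  let b0 := hI.collectedBasis fun i => (stdOrthonormalBasis ℂ _).toBasis
  have hb0 : Orthonormal ℂ b0 := hO.orthonormal_sigma_orthonormal
    (v_family := fun i => (stdOrthonormalBasis ℂ _).toBasis) (by simp) |> fun h => by
      simpa [b0] using h
  have hb0m : ∀ a, b0 a ∈ _ := hI.collectedBasis_mem fun i => (stdOrthonormalBasis ℂ _).toBasis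
  haveI : Fintype (Σ i : ℂ × ℂ, Fin (Module.finrank ℂ
    (Module.End.eigenspace (Matrix.toEuclideanLin H) i.2 ⊓
      Module.End.eigenspace (Matrix.toEuclideanLin ρ) i.1 :
        Submodule ℂ (EuclideanSpace ℂ (Fin n))))) := FiniteDimensional.fintypeBasisIndex b0
  let e := Fintype.equivFinOfCardEq ((Module.finrank_eq_card_basis b0).symm.trans
    (finrank_euclideanSpace_fin (𝕜 := ℂ) (n := n)))
  let b := (b0.toOrthonormalBasis hb0).reindex e
  have hb : ∀ j, b j = b0 (e.symm j) := by intro j; simp [b]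
  let V : Matrix (Fin n) (Fin n) ℂ := Matrix.of fun i j => b j i
  have hV : V ∈ Matrix.unitaryGroup (Fin n) ℂ :=
    (EuclideanSpace.basisFun (Fin n) ℂ).toMatrix_orthonormalBasis_mem_unitary b
  refine ⟨V, hV, fun j => ((e.symm j).1.2).re, fun j => ((e.symm j).1.1).re,
    real_diag H V hH hV (fun j => (e.symm j).1.2) ?_,
    real_diag ρ V hρ hV (fun j => (e.symm j).1.1) ?_⟩
  · ext i j
    have h := Module.End.mem_eigenspace_iff.1 (hb0m (e.symm j)).1
    rw [← hb] at h
    have h' := congrArg (fun x : EuclideanSpace ℂ (Fin n) => x i) h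
    simp only [Matrix.toLpLin_apply] at h'
    rw [Matrix.mul_diagonal, Matrix.mul_apply]
    simpa [Matrix.mulVec, dotProduct, V, mul_comm] using h'
  · ext i j
    have h := Module.End.mem_eigenspace_iff.1 (hb0m (e.symm j)).2
    rw [← hb] at h
    have h' := congrArg (fun x : EuclideanSpace ℂ (Fin n) => x i) h
    simp only [Matrix.toLpLin_apply] at h'
    rw [Matrix.mul_diagonal, Matrix.mul_apply]
    simpa [Matrix.mulVec, dotProduct, V, mul_comm] using h'

lemma reindex_diag {n : ℕ} (V : Matrix (Fin n) (Fin n) ℂ) (σ : Equiv.Perm (Fin n))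
    (d : Fin n → ℂ) :
    V.submatrix id σ * Matrix.diagonal (fun m => d (σ m)) * (V.submatrix id σ)ᴴ =
      V * Matrix.diagonal d * Vᴴ := by
  ext i j
  rw [Matrix.mul_apply, Matrix.mul_apply]
  simp only [Matrix.mul_diagonal, Matrix.conjTranspose_apply, Matrix.submatrix_apply, id]
  exact Equiv.sum_comp σ (fun k => V i k * d k * star (V j k))

lemma conj_trace {n : ℕ} (V U D F : Matrix (Fin n) (Fin n) ℂ) :
    Matrix.trace ((V * D * Vᴴ) * (U * (V * F * Vᴴ) * Uᴴ)) =
      Matrix.trace (D * ((Vᴴ * U * V) * F * (Vᴴ * U * V)ᴴ)) := by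
  simp only [Matrix.conjTranspose_mul, Matrix.conjTranspose_conjTranspose]
  simp only [Matrix.mul_assoc]
  rw [Matrix.trace_mul_comm]
  simp only [Matrix.mul_assoc]

lemma self_trace {n : ℕ} (V : Matrix (Fin n) (Fin n) ℂ)
    (hV : V ∈ Matrix.unitaryGroup (Fin n) ℂ) (E q : Fin n → ℝ) :
    (Matrix.trace ((V * Matrix.diagonal (fun m => (E m : ℂ)) * Vᴴ) *
      (V * Matrix.diagonal (fun m => (q m : ℂ)) * Vᴴ))).re = ∑ i, E i * q i := by
  have h2 : Vᴴ * V = 1 := Matrix.mem_unitaryGroup_iff'.1 hV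
  have := conj_trace V 1 (Matrix.diagonal (fun m => (E m : ℂ)))
    (Matrix.diagonal (fun m => (q m : ℂ)))
  simp only [Matrix.one_mul, Matrix.mul_one, Matrix.conjTranspose_one, h2] at this
  rw [this]
  simp [Matrix.trace]

lemma swap_ineq {n : ℕ} (E q : Fin n → ℝ)
    (h : ∀ σ : Equiv.Perm (Fin n), ∑ i, E i * q i ≤ ∑ i, E i * q (σ i)) (i j : Fin n)
    (hij : E i < E j) : q j ≤ q i := by
  have hne : i ≠ j := by rintro rfl; exact lt_irrefl _ hij
  have h1 := h (Equiv.swap i j)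
  rw [← sub_nonneg, ← Finset.sum_sub_distrib, Finset.sum_eq_add i j hne] at h1
  · simp only [Equiv.swap_apply_left, Equiv.swap_apply_right] at h1
    by_contra hc
    push Not at hc
    nlinarith
  · rintro k - ⟨h2, h3⟩
    rw [Equiv.swap_apply_of_ne_of_ne h2 h3, sub_self]
  · simp
  · simp

theorem passive_state_iff (n : ℕ) (H ρ : Matrix (Fin n) (Fin n) ℂ)
    (hH : H.IsHermitian) (hρ : ρ.PosSemidef) (hρtr : ρ.trace = 1) :
    (∀ U ∈ Matrix.unitaryGroup (Fin n) ℂ,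
        ((H * ρ).trace).re ≤ ((H * (U * ρ * Uᴴ)).trace).re) ↔
      ∃ V ∈ Matrix.unitaryGroup (Fin n) ℂ, ∃ E q : Fin n → ℝ,
        Monotone E ∧ Antitone q ∧ (∀ m, 0 ≤ q m) ∧
        H = V * Matrix.diagonal (fun m => (E m : ℂ)) * Vᴴ ∧
        ρ = V * Matrix.diagonal (fun m => (q m : ℂ)) * Vᴴ := by
  constructor
  · intro h
    obtain ⟨V, hV, E, q, hE, hq⟩ :=
      simul_diag H ρ hH hρ.1 (commute_of_passive H ρ hH hρ.1 h)
    have h1 : V * Vᴴ = 1 := Matrix.mem_unitaryGroup_iff.1 hV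
    have h2 : Vᴴ * V = 1 := Matrix.mem_unitaryGroup_iff'.1 hV
    have hVs : Vᴴ ∈ Matrix.unitaryGroup (Fin n) ℂ := Unitary.star_mem hV
    have hperm : ∀ σ : Equiv.Perm (Fin n), ∑ i, E i * q i ≤ ∑ i, E i * q (σ i) := by
      intro σ
      have hP : σ.permMatrix ℂ ∈ Matrix.unitaryGroup (Fin n) ℂ := by
        rw [Matrix.mem_unitaryGroup_iff, Matrix.star_eq_conjTranspose,
          Matrix.conjTranspose_permMatrix, ← Matrix.permMatrix_mul]
        simp
      have h3 := h (V * σ.permMatrix ℂ * Vᴴ) (mul_mem (mul_mem hV hP) hVs)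
      have h4 : Vᴴ * (V * σ.permMatrix ℂ * Vᴴ) * V = σ.permMatrix ℂ := by
        rw [Matrix.mul_assoc, Matrix.mul_assoc, h2, Matrix.mul_one, ← Matrix.mul_assoc, h2,
          Matrix.one_mul]
      rw [hE, hq, self_trace V hV, conj_trace, h4, trace_formula] at h3
      refine h3.trans (le_of_eq (Finset.sum_congr rfl fun i _ => ?_))
      rw [Finset.sum_eq_single (σ i)]
      · simp [Equiv.Perm.permMatrix, PEquiv.toMatrix_apply]
      · intro j _ hj
        simp [Equiv.Perm.permMatrix, PEquiv.toMatrix_apply, hj.symm]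
      · simp
    have hq0 : ∀ m, 0 ≤ q m := by
      have h5 := hρ.conjTranspose_mul_mul_same V
      have h6 : Vᴴ * ρ * V = Matrix.diagonal (fun m => (q m : ℂ)) := by
        rw [hq, Matrix.mul_assoc, Matrix.mul_assoc, h2, Matrix.mul_one, ← Matrix.mul_assoc, h2,
          Matrix.one_mul]
      rw [h6, Matrix.posSemidef_diagonal_iff] at h5
      intro m
      exact_mod_cast h5 m
    let f : Fin n → ℝ ×ₗ ℝ := fun i => toLex (E i, - q i)
    have hm := Tuple.monotone_sort f
    set σ := Tuple.sort f
    have hlex : ∀ i j, i ≤ j → E (σ i) < E (σ j) ∨ E (σ i) = E (σ j) ∧ -q (σ i) ≤ -q (σ j) := by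
      intro i j hij
      simpa [f, Prod.Lex.toLex_le_toLex] using hm hij
    refine ⟨V.submatrix id σ, ?_, fun i => E (σ i), fun i => q (σ i), ?_, ?_,
      fun m => hq0 _, ?_, ?_⟩
    · rw [Matrix.mem_unitaryGroup_iff', Matrix.star_eq_conjTranspose,
        Matrix.conjTranspose_submatrix, ← Matrix.submatrix_mul _ _ _ _ _ Function.bijective_id, h2]
      simp
    · intro i j hij
      rcases hlex i j hij with h | h
      · exact h.le
      · exact h.1.le
    · intro i j hij
      rcases hlex i j hij with h | h
      · exact swap_ineq E q hperm _ _ h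
      · exact neg_le_neg_iff.1 h.2
    · rw [reindex_diag V σ (fun m => (E m : ℂ))]; exact hE
    · rw [reindex_diag V σ (fun m => (q m : ℂ))]; exact hq
  · rintro ⟨V, hV, E, q, hE, hq, -, rfl, rfl⟩ U hU
    have hVs : Vᴴ ∈ Matrix.unitaryGroup (Fin n) ℂ := Unitary.star_mem hV
    rw [self_trace V hV, conj_trace, trace_formula]
    exact ds_bound E q hE hq _ (mul_mem (mul_mem hVs hU) hV)
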